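/- Let φ : ℝⁿ × ℝᵐ → ℝ be C² and concave-convex, let z̄ be a saddle point of φ, and let z(·) be a solution of the gradient dynamics with |z(t) − z̄| constant in t. Then for every s ∈ [0,1], the curve z′(t) = (1−s)·z̄ + s·z(t) is also a solution of the gradient dynamics with |z′(t) − z̄| constant in t. If moreover z(·) ∈ S, then z′(·) ∈ S. -/

import Mathlib

open scoped BigOperators

noncomputable section

/-- Points of `ℝⁿ × ℝᵐ`. -/
abbrev Pt (n m : ℕ) := (Fin n → ℝ) × (Fin m → ℝ)

variable {n m : ℕ}

/-- The Euclidean distance on `ℝⁿ × ℝᵐ`. -/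
def eDist (a b : Pt n m) : ℝ :=
  Real.sqrt (∑ i, (a.1 i - b.1 i) ^ 2 + ∑ j, (a.2 j - b.2 j) ^ 2)

/-- The Euclidean inner product on `ℝⁿ × ℝᵐ`. -/
def ip (a b : Pt n m) : ℝ := ∑ i, a.1 i * b.1 i + ∑ j, a.2 j * b.2 j

/-- `φ` is concave-convex: concave in `x` for each fixed `y`, convex in `y` for each fixed `x`. -/
def ConcaveConvex (φ : Pt n m → ℝ) : Prop :=
  (∀ y, ConcaveOn ℝ Set.univ fun x => φ (x, y)) ∧
    (∀ x, ConvexOn ℝ Set.univ fun y => φ (x, y))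

/-- `zb` is a saddle point of `φ`. -/
def IsSaddle (φ : Pt n m → ℝ) (zb : Pt n m) : Prop :=
  ∀ x y, φ (x, zb.2) ≤ φ zb ∧ φ zb ≤ φ (zb.1, y)

/-- The gradient of `φ` in the `x` variables. -/
def gradX (φ : Pt n m → ℝ) (z : Pt n m) : Fin n → ℝ :=
  fun i => fderiv ℝ φ z (Pi.single i 1, 0)

/-- The gradient of `φ` in the `y` variables. -/
def gradY (φ : Pt n m → ℝ) (z : Pt n m) : Fin m → ℝ :=
  fun j => fderiv ℝ φ z (0, Pi.single j 1)

/-- `z : ℝ → ℝⁿ × ℝᵐ` is a (global, C¹) solution of the gradient dynamics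
`ẋ = ∇ₓφ, ẏ = -∇_yφ`. -/
def IsSolution (φ : Pt n m → ℝ) (z : ℝ → Pt n m) : Prop :=
  ∀ t, HasDerivAt z (gradX φ (z t), -gradY φ (z t)) t

/-- `z ∈ 𝒮`: a solution of the gradient dynamics lying at constant distance
from every saddle point. -/
def InS (φ : Pt n m → ℝ) (z : ℝ → Pt n m) : Prop :=
  IsSolution φ z ∧ ∀ zb, IsSaddle φ zb → ∀ t, eDist (z t) zb = eDist (z 0) zb

/-- Second directional derivative of `φ` at `z`, in directions `u` then `v`. -/
def hess (φ : Pt n m → ℝ) (z u v : Pt n m) : ℝ :=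
  fderiv ℝ (fun w => fderiv ℝ φ w u) z v

/-- The `i`th coordinate direction in the `x` variables. -/
def ex (i : Fin n) : Pt n m := (Pi.single i 1, 0)

/-- The `j`th coordinate direction in the `y` variables. -/
def ey (j : Fin m) : Pt n m := (0, Pi.single j 1)

/-- The matrix `A(z) = [[0, φ_{xy}(z)], [-φ_{yx}(z), 0]]`. -/
def matA (φ : Pt n m → ℝ) (z : Pt n m) : Matrix (Fin n ⊕ Fin m) (Fin n ⊕ Fin m) ℝ :=
  Matrix.fromBlocks 0 (Matrix.of fun i j => hess φ z (ex i) (ey j))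
    (Matrix.of fun j i => -hess φ z (ey j) (ex i)) 0

/-- The matrix `B(z) = [[φ_{xx}(z), 0], [0, -φ_{yy}(z)]]`. -/
def matB (φ : Pt n m → ℝ) (z : Pt n m) : Matrix (Fin n ⊕ Fin m) (Fin n ⊕ Fin m) ℝ :=
  Matrix.fromBlocks (Matrix.of fun i i' => hess φ z (ex i) (ex i')) 0 0
    (Matrix.of fun j j' => -hess φ z (ey j) (ey j'))

/-- A point of `ℝⁿ × ℝᵐ` viewed as a vector indexed by `Fin n ⊕ Fin m`. -/
def vec (z : Pt n m) : Fin n ⊕ Fin m → ℝ := Sum.elim z.1 z.2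

/-- A vector indexed by `Fin n ⊕ Fin m` viewed as a point of `ℝⁿ × ℝᵐ`. -/
def unvec (v : Fin n ⊕ Fin m → ℝ) : Pt n m :=
  (fun i => v (Sum.inl i), fun j => v (Sum.inr j))

end

lemma eDist_eq_sqrt_ip {n m : ℕ} (a b : Pt n m) : eDist a b = √(ip (a - b) (a - b)) := by
  simp [eDist, ip, sq]

lemma ip_self_nonneg {n m : ℕ} (a : Pt n m) : 0 ≤ ip a a :=
  add_nonneg (Finset.sum_nonneg fun _ _ => mul_self_nonneg _)
    (Finset.sum_nonneg fun _ _ => mul_self_nonneg _)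

lemma eq_zero_of_ip_self_nonpos {n m : ℕ} {a : Pt n m} (h : ip a a ≤ 0) : a = 0 := by
  have h₁ : 0 ≤ ∑ i, a.1 i * a.1 i := Finset.sum_nonneg fun _ _ => mul_self_nonneg _
  have h₂ : 0 ≤ ∑ j, a.2 j * a.2 j := Finset.sum_nonneg fun _ _ => mul_self_nonneg _
  have h' : ∑ i, a.1 i * a.1 i + ∑ j, a.2 j * a.2 j ≤ 0 := h
  have e₁ := (Finset.sum_eq_zero_iff_of_nonneg fun i _ => mul_self_nonneg (a.1 i)).1
    (by linarith : ∑ i, a.1 i * a.1 i = 0)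
  have e₂ := (Finset.sum_eq_zero_iff_of_nonneg fun j _ => mul_self_nonneg (a.2 j)).1
    (by linarith : ∑ j, a.2 j * a.2 j = 0)
  ext i
  · simpa using e₁ i (Finset.mem_univ i)
  · simpa using e₂ i (Finset.mem_univ i)

/-- Stewart's identity for the Euclidean square norm of a convex combination. -/
lemma ip_self_combination {n m : ℕ} (s : ℝ) (p q : Pt n m) :
    ip ((1 - s) • p + s • q) ((1 - s) • p + s • q) =
      (1 - s) * ip p p + s * ip q q - s * (1 - s) * ip (q - p) (q - p) := by
  simp only [ip, Prod.fst_add, Prod.snd_add, Prod.smul_fst, Prod.smul_snd, Prod.fst_sub,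
    Prod.snd_sub, Pi.add_apply, Pi.smul_apply, Pi.sub_apply, smul_eq_mul, mul_add,
    Finset.mul_sum]
  have h (k : ℕ) (f g : Fin k → ℝ) :
      ∑ i, ((1 - s) * f i + s * g i) * ((1 - s) * f i + s * g i) =
        ∑ i, (1 - s) * (f i * f i) + ∑ i, s * (g i * g i)
          - ∑ i, s * (1 - s) * ((g i - f i) * (g i - f i)) := by
    rw [← Finset.sum_add_distrib, ← Finset.sum_sub_distrib]
    exact Finset.sum_congr rfl fun i _ => by ring
  have h₁ := h n p.1 q.1
  have h₂ := h m p.2 q.2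
  simp only [mul_add] at h₁ h₂
  linarith

lemma ip_sub_combination_self {n m : ℕ} (s : ℝ) (a b c : Pt n m) :
    ip ((1 - s) • a + s • b - c) ((1 - s) • a + s • b - c) =
      (1 - s) * ip (a - c) (a - c) + s * ip (b - c) (b - c)
        - s * (1 - s) * ip (b - a) (b - a) := by
  have h := ip_self_combination s (a - c) (b - c)
  rwa [sub_sub_sub_cancel_right,
    show (1 - s) • (a - c) + s • (b - c) = (1 - s) • a + s • b - c by module] at h

lemma ip_sub_left {n m : ℕ} (a b c : Pt n m) : ip (a - b) c = ip a c - ip b c := by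
  simp only [ip, Prod.fst_sub, Prod.snd_sub, Pi.sub_apply, sub_mul, Finset.sum_sub_distrib]
  ring

lemma hasDerivAt_ip_self {n m : ℕ} {u : ℝ → Pt n m} {u' : Pt n m} {t : ℝ}
    (h : HasDerivAt u u' t) : HasDerivAt (fun t => ip (u t) (u t)) (2 * ip u' (u t)) t := by
  have h₁ := hasDerivAt_pi.1 h.fst
  have h₂ := hasDerivAt_pi.1 h.snd
  have := (HasDerivAt.fun_sum fun i (_ : i ∈ Finset.univ) => (h₁ i).mul (h₁ i)).add
    (HasDerivAt.fun_sum fun j (_ : j ∈ Finset.univ) => (h₂ j).mul (h₂ j))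
  refine this.congr_deriv ?_
  simp only [ip, mul_add, Finset.mul_sum]
  congr 1 <;> exact Finset.sum_congr rfl fun i _ => by ring

/-- The vector field of the gradient dynamics. -/
noncomputable def gradField {n m : ℕ} (φ : Pt n m → ℝ) (z : Pt n m) : Pt n m :=
  (gradX φ z, -gradY φ z)

lemma contDiff_gradField {n m : ℕ} {φ : Pt n m → ℝ} (hφ : ContDiff ℝ 2 φ) :
    ContDiff ℝ 1 (gradField φ) := by
  have h : ContDiff ℝ 1 (fderiv ℝ φ) := hφ.fderiv_right (by norm_num)
  refine ContDiff.prodMk (contDiff_pi.2 fun i => h.clm_apply contDiff_const)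
    (ContDiff.neg (contDiff_pi.2 fun j => h.clm_apply contDiff_const))

lemma ip_gradField {n m : ℕ} (φ : Pt n m → ℝ) (a v : Pt n m) :
    ip (gradField φ a) v = fderiv ℝ φ a (v.1, 0) - fderiv ℝ φ a (0, v.2) := by
  have h₁ := LinearMap.pi_apply_eq_sum_univ
    ((fderiv ℝ φ a).toLinearMap ∘ₗ LinearMap.inl ℝ (Fin n → ℝ) (Fin m → ℝ)) v.1
  have h₂ := LinearMap.pi_apply_eq_sum_univ
    ((fderiv ℝ φ a).toLinearMap ∘ₗ LinearMap.inr ℝ (Fin n → ℝ) (Fin m → ℝ)) v.2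
  simp only [LinearMap.comp_apply, LinearMap.inl_apply, LinearMap.inr_apply,
    ContinuousLinearMap.coe_coe, smul_eq_mul] at h₁ h₂
  rw [h₁, h₂]
  have e (k : ℕ) (i : Fin k) : (fun j => if i = j then (1 : ℝ) else 0) = Pi.single i 1 := by
    ext j; simp [Pi.single_apply, eq_comm]
  simp [ip, gradField, gradX, gradY, e, mul_comm, sub_eq_add_neg]

/-- The gradient inequality for convex functions. -/
lemma ConvexOn.add_fderiv_le {E : Type*} [NormedAddCommGroup E] [NormedSpace ℝ E]
    {f : E → ℝ} {f' : E →L[ℝ] ℝ} {x : E} (hf : ConvexOn ℝ Set.univ f)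
    (h : HasFDerivAt f f' x) (y : E) : f x + f' (y - x) ≤ f y := by
  have hg : ConvexOn ℝ Set.univ (f ∘ AffineMap.lineMap (k := ℝ) x y) :=
    hf.comp_affineMap (AffineMap.lineMap x y)
  have hd : HasDerivAt (f ∘ AffineMap.lineMap (k := ℝ) x y) (f' (y - x)) 0 := by
    refine HasFDerivAt.comp_hasDerivAt (x := (0 : ℝ)) ?_ AffineMap.hasDerivAt_lineMap
    simpa using h
  have := hg.le_slope_of_hasDerivAt (Set.mem_univ 0) (Set.mem_univ 1) one_pos hd
  rw [slope_def_field] at this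
  simp only [Function.comp_apply, AffineMap.lineMap_apply_zero, AffineMap.lineMap_apply_one,
    sub_zero, div_one] at this
  linarith

lemma ConcaveConvex.le_add_fderiv {n m : ℕ} {φ : Pt n m → ℝ} (hcc : ConcaveConvex φ)
    (hφ : Differentiable ℝ φ) (a : Pt n m) (x : Fin n → ℝ) :
    φ (x, a.2) ≤ φ a + fderiv ℝ φ a (x - a.1, 0) := by
  have hd := HasFDerivAt.comp a.1 (hφ a).hasFDerivAt (hasFDerivAt_prodMk_left (𝕜 := ℝ) a.1 a.2)
  have := (hcc.1 a.2).neg.add_fderiv_le hd.neg x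
  simp at this
  linarith

lemma ConcaveConvex.add_fderiv_le {n m : ℕ} {φ : Pt n m → ℝ} (hcc : ConcaveConvex φ)
    (hφ : Differentiable ℝ φ) (a : Pt n m) (y : Fin m → ℝ) :
    φ a + fderiv ℝ φ a (0, y - a.2) ≤ φ (a.1, y) := by
  have hd := HasFDerivAt.comp a.2 (hφ a).hasFDerivAt (hasFDerivAt_prodMk_right (𝕜 := ℝ) a.1 a.2)
  have := (hcc.2 a.1).add_fderiv_le hd y
  simpa using this

/-- The vector field of the gradient dynamics points towards every saddle point. -/
lemma IsSaddle.ip_gradField_nonpos {n m : ℕ} {φ : Pt n m → ℝ} {c : Pt n m}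
    (hc : IsSaddle φ c) (hcc : ConcaveConvex φ) (hφ : Differentiable ℝ φ) (a : Pt n m) :
    ip (gradField φ a) (a - c) ≤ 0 := by
  have h₁ := hcc.le_add_fderiv hφ a c.1
  have h₂ := hcc.add_fderiv_le hφ a c.2
  have h₃ := hc a.1 a.2
  have e₁ : fderiv ℝ φ a (c.1 - a.1, 0) = -fderiv ℝ φ a (a.1 - c.1, 0) := by
    rw [← map_neg]; simp
  have e₂ : fderiv ℝ φ a (0, c.2 - a.2) = -fderiv ℝ φ a (0, a.2 - c.2) := by
    rw [← map_neg]; simp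
  rw [ip_gradField, Prod.fst_sub, Prod.snd_sub]
  linarith

/-- The negative of the vector field of the gradient dynamics is monotone. -/
lemma ConcaveConvex.ip_gradField_sub_nonpos {n m : ℕ} {φ : Pt n m → ℝ}
    (hcc : ConcaveConvex φ) (hφ : Differentiable ℝ φ) (a b : Pt n m) :
    ip (gradField φ a - gradField φ b) (a - b) ≤ 0 := by
  have h₁ := hcc.le_add_fderiv hφ a b.1
  have h₂ := hcc.add_fderiv_le hφ a b.2
  have h₃ := hcc.le_add_fderiv hφ b a.1
  have h₄ := hcc.add_fderiv_le hφ b a.2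
  have e₁ : fderiv ℝ φ a (b.1 - a.1, 0) = -fderiv ℝ φ a (a.1 - b.1, 0) := by
    rw [← map_neg]; simp
  have e₂ : fderiv ℝ φ a (0, b.2 - a.2) = -fderiv ℝ φ a (0, a.2 - b.2) := by
    rw [← map_neg]; simp
  rw [ip_sub_left, ip_gradField, ip_gradField, Prod.fst_sub, Prod.snd_sub]
  linarith

/-- Along a solution at constant distance from a saddle point, the vector field is linear on
the segment joining the saddle point to the solution: a solution started on the segment stays
on it, by the equality case of the triangle inequality. -/
lemma gradField_combination {n m : ℕ} {φ : Pt n m → ℝ} (hφ : ContDiff ℝ 2 φ)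
    (hcc : ConcaveConvex φ) {c : Pt n m} (hc : IsSaddle φ c) {z : ℝ → Pt n m}
    (hz : IsSolution φ z) {R : ℝ} (hR : ∀ t, ip (z t - c) (z t - c) = R) {s : ℝ}
    (hs : s ∈ Set.Icc (0 : ℝ) 1) (t₀ : ℝ) :
    s • gradField φ (z t₀) = gradField φ ((1 - s) • c + s • z t₀) := by
  have hd : Differentiable ℝ φ := hφ.differentiable (by norm_num)
  obtain ⟨w, hw₀, ε, hε, hw⟩ := (contDiff_gradField hφ).contDiffAt
    (x := (1 - s) • c + s • z t₀)
    |>.exists_forall_mem_closedBall_exists_eq_forall_mem_Ioo_hasDerivAt₀ t₀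
  have anti {u v : ℝ → Pt n m}
      (hu : ∀ t ∈ Set.Ioo (t₀ - ε) (t₀ + ε), HasDerivAt u (v t) t)
      (huv : ∀ t, ip (v t) (u t) ≤ 0) {t : ℝ} (ht : t ∈ Set.Ico t₀ (t₀ + ε)) :
      ip (u t) (u t) ≤ ip (u t₀) (u t₀) := by
    have hder := fun t ht => hasDerivAt_ip_self (hu t ht)
    refine antitoneOn_of_deriv_nonpos (convex_Ioo (t₀ - ε) (t₀ + ε))
      (fun t ht => (hder t ht).continuousAt.continuousWithinAt)
      (fun t ht => (hder t (interior_subset ht)).differentiableAt.differentiableWithinAt)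
      (fun t ht => ?_) ⟨by linarith, by linarith⟩ ⟨by linarith [ht.1], ht.2⟩ ht.1
    rw [(hder t (interior_subset ht)).deriv]
    linarith [huv t]
  have heq : ∀ t ∈ Set.Ico t₀ (t₀ + ε), (1 - s) • c + s • z t = w t := by
    intro t ht
    have h₁ := anti (u := fun t => w t - c) (fun t ht => (hw t ht).sub_const c)
      (fun t => hc.ip_gradField_nonpos hcc hd (w t)) ht
    have h₂ := anti (u := fun t => w t - z t) (fun t ht => (hw t ht).sub (hz t))
      (fun t => hcc.ip_gradField_sub_nonpos hd (w t) (z t)) ht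
    simp only [hw₀] at h₁ h₂
    have e₁ := ip_sub_combination_self s c (z t₀) c
    have e₂ := ip_sub_combination_self s c (z t₀) (z t₀)
    have e₃ := ip_sub_combination_self s c (z t) (w t)
    have sw (a b : Pt n m) : ip (a - b) (a - b) = ip (b - a) (b - a) := by
      simp only [ip, Prod.fst_sub, Prod.snd_sub, Pi.sub_apply]
      congr 1 <;> exact Finset.sum_congr rfl fun i _ => by ring
    rw [sub_self c, hR] at e₁
    rw [sub_self (z t₀), sw c, hR] at e₂
    rw [sw c, sw (z t), hR] at e₃
    have z0 : ip (0 : Pt n m) 0 = 0 := by simp [ip]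
    rw [z0] at e₁ e₂
    have h0 : 0 ≤ s := hs.1
    have h1 : 0 ≤ 1 - s := sub_nonneg.2 hs.2
    refine sub_eq_zero.1 (eq_zero_of_ip_self_nonpos ?_)
    have k₁ := mul_le_mul_of_nonneg_left (h₁.trans_eq e₁) h1
    have k₂ := mul_le_mul_of_nonneg_left (h₂.trans_eq e₂) h0
    rw [e₃]
    linarith
  have hz' : HasDerivWithinAt (fun t => (1 - s) • c + s • z t) (s • gradField φ (z t₀))
      (Set.Ici t₀) t₀ := (((hz t₀).const_smul s).const_add _).hasDerivWithinAt
  have hw' : HasDerivWithinAt (fun t => (1 - s) • c + s • z t) (gradField φ (w t₀))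
      (Set.Ici t₀) t₀ := by
    refine (hw t₀ ⟨by linarith, by linarith⟩).hasDerivWithinAt.congr_of_eventuallyEq ?_
      (heq t₀ ⟨le_rfl, by linarith⟩)
    filter_upwards [Ico_mem_nhdsGE (show t₀ < t₀ + ε by linarith)] using heq
  rw [← hw₀]
  exact (uniqueDiffWithinAt_Ici t₀).eq_deriv _ hz' hw'

lemma eDist_eq_iff {n m : ℕ} {a b c d : Pt n m} :
    eDist a b = eDist c d ↔ ip (a - b) (a - b) = ip (c - d) (c - d) := by
  rw [eDist_eq_sqrt_ip, eDist_eq_sqrt_ip, Real.sqrt_inj (ip_self_nonneg _) (ip_self_nonneg _)]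

/-- Convex combinations of a saddle point `zb` with a solution at constant
distance from `zb` are again solutions at constant distance from `zb`; and if the original
solution is in `𝒮`, so is the convex combination. -/
theorem convex_combination_with_saddle {n m : ℕ} (φ : Pt n m → ℝ)
    (hφ : ContDiff ℝ 2 φ) (hcc : ConcaveConvex φ)
    (zb : Pt n m) (hzb : IsSaddle φ zb)
    (z : ℝ → Pt n m) (hz : IsSolution φ z)
    (hconst : ∀ t, eDist (z t) zb = eDist (z 0) zb)
    (s : ℝ) (hs : s ∈ Set.Icc (0 : ℝ) 1) :
    (IsSolution φ (fun t => (1 - s) • zb + s • z t) ∧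
      (∀ t, eDist ((1 - s) • zb + s • z t) zb = eDist ((1 - s) • zb + s • z 0) zb)) ∧
    (InS φ z → InS φ (fun t => (1 - s) • zb + s • z t)) := by
  have hR : ∀ t, ip (z t - zb) (z t - zb) = ip (z 0 - zb) (z 0 - zb) :=
    fun t => eDist_eq_iff.1 (hconst t)
  have hsol : IsSolution φ (fun t => (1 - s) • zb + s • z t) := fun t =>
    (((hz t).const_smul s).const_add _).congr_deriv
      (gradField_combination hφ hcc hzb hz hR hs t)
  have hdist (c : Pt n m) (hc : ∀ t, eDist (z t) c = eDist (z 0) c) (t : ℝ) :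
      eDist ((1 - s) • zb + s • z t) c = eDist ((1 - s) • zb + s • z 0) c := by
    rw [eDist_eq_iff, ip_sub_combination_self, ip_sub_combination_self, hR t,
      eDist_eq_iff.1 (hc t)]
  exact ⟨⟨hsol, hdist zb hconst⟩, fun h => ⟨hsol, fun c hc => hdist c (h.2 c hc)⟩⟩
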